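/- (Strong conservativity.) If H is a set of sequents and Π → B a sequent, all in the product-free language (built with \, /, ∧, 0, 1), and Π → B is derivable from H in L^Λ(∧,0,1), then Π → B is derivable from H in the product-free fragment L^Λ_{\,/}(∧,0,1). Moreover, if H and Π → B contain no constants 0 and 1, then Π → B is derivable from H in L^Λ_{\,/}(∧). -/

import Mathlib

/-- Formulae of the Lambek calculus with intersection and constants 0 and 1. -/
inductive Fm where
  | var : ℕ → Fm                -- propositional variable
  | zero : Fm                   -- constant 0
  | one : Fm                    -- constant 1
  | mul : Fm → Fm → Fm          -- product A·B
  | ldiv : Fm → Fm → Fm         -- left division A\B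
  | rdiv : Fm → Fm → Fm         -- right division B/A
  | inter : Fm → Fm → Fm        -- intersection A∧B

/-- Derivability of sequents in `L^Λ(∧,0,1)` from a set `H` of extra (non-logical)
axioms.  A sequent is a pair of a list of formulae (antecedent) and a formula
(succedent). -/
inductive Deriv (H : Set (List Fm × Fm)) : List Fm → Fm → Prop
  | hyp {P B} : (P, B) ∈ H → Deriv H P B
  | id (A) : Deriv H [A] A
  | oneR : Deriv H [] Fm.one
  | zeroL (Γ Δ C) : Deriv H (Γ ++ [Fm.zero] ++ Δ) C
  | cut {P A Γ Δ C} : Deriv H P A → Deriv H (Γ ++ [A] ++ Δ) C →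
      Deriv H (Γ ++ P ++ Δ) C
  | ldivL {P A Γ B Δ C} : Deriv H P A → Deriv H (Γ ++ [B] ++ Δ) C →
      Deriv H (Γ ++ P ++ [Fm.ldiv A B] ++ Δ) C
  | ldivR {P A B} : Deriv H (A :: P) B → Deriv H P (Fm.ldiv A B)
  | rdivL {P A Γ B Δ C} : Deriv H P A → Deriv H (Γ ++ [B] ++ Δ) C →
      Deriv H (Γ ++ [Fm.rdiv B A] ++ P ++ Δ) C
  | rdivR {P A B} : Deriv H (P ++ [A]) B → Deriv H P (Fm.rdiv B A)
  | mulL {Γ A B Δ C} : Deriv H (Γ ++ [A, B] ++ Δ) C →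
      Deriv H (Γ ++ [Fm.mul A B] ++ Δ) C
  | mulR {P A Δ B} : Deriv H P A → Deriv H Δ B → Deriv H (P ++ Δ) (Fm.mul A B)
  | andL1 {Γ A B Δ C} : Deriv H (Γ ++ [A] ++ Δ) C →
      Deriv H (Γ ++ [Fm.inter A B] ++ Δ) C
  | andL2 {Γ A B Δ C} : Deriv H (Γ ++ [B] ++ Δ) C →
      Deriv H (Γ ++ [Fm.inter A B] ++ Δ) C
  | andR {P A B} : Deriv H P A → Deriv H P B → Deriv H P (Fm.inter A B)
  | oneL {Γ Δ C} : Deriv H (Γ ++ Δ) C → Deriv H (Γ ++ [Fm.one] ++ Δ) C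

/-- A formula is product-free if it is built from variables and the constants 0, 1
using only `\`, `/`, and `∧`. -/
def ProdFree : Fm → Prop
  | Fm.var _ => True
  | Fm.zero => True
  | Fm.one => True
  | Fm.mul _ _ => False
  | Fm.ldiv A B => ProdFree A ∧ ProdFree B
  | Fm.rdiv B A => ProdFree B ∧ ProdFree A
  | Fm.inter A B => ProdFree A ∧ ProdFree B

/-- A formula contains no constants 0 and 1. -/
def ConstFree : Fm → Prop
  | Fm.var _ => True
  | Fm.zero => False
  | Fm.one => False
  | Fm.mul A B => ConstFree A ∧ ConstFree B
  | Fm.ldiv A B => ConstFree A ∧ ConstFree B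
  | Fm.rdiv B A => ConstFree B ∧ ConstFree A
  | Fm.inter A B => ConstFree A ∧ ConstFree B

/-- Derivability from hypotheses `H` in the product-free fragment `L^Λ_{\,/}(∧,0,1)`:
the rules of `L^Λ(∧,0,1)` without `·L` and `·R`. -/
inductive DerivPF (H : Set (List Fm × Fm)) : List Fm → Fm → Prop
  | hyp {P B} : (P, B) ∈ H → DerivPF H P B
  | id (A) : DerivPF H [A] A
  | oneR : DerivPF H [] Fm.one
  | zeroL (Γ Δ C) : DerivPF H (Γ ++ [Fm.zero] ++ Δ) C
  | cut {P A Γ Δ C} : DerivPF H P A → DerivPF H (Γ ++ [A] ++ Δ) C →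
      DerivPF H (Γ ++ P ++ Δ) C
  | ldivL {P A Γ B Δ C} : DerivPF H P A → DerivPF H (Γ ++ [B] ++ Δ) C →
      DerivPF H (Γ ++ P ++ [Fm.ldiv A B] ++ Δ) C
  | ldivR {P A B} : DerivPF H (A :: P) B → DerivPF H P (Fm.ldiv A B)
  | rdivL {P A Γ B Δ C} : DerivPF H P A → DerivPF H (Γ ++ [B] ++ Δ) C →
      DerivPF H (Γ ++ [Fm.rdiv B A] ++ P ++ Δ) C
  | rdivR {P A B} : DerivPF H (P ++ [A]) B → DerivPF H P (Fm.rdiv B A)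
  | andL1 {Γ A B Δ C} : DerivPF H (Γ ++ [A] ++ Δ) C →
      DerivPF H (Γ ++ [Fm.inter A B] ++ Δ) C
  | andL2 {Γ A B Δ C} : DerivPF H (Γ ++ [B] ++ Δ) C →
      DerivPF H (Γ ++ [Fm.inter A B] ++ Δ) C
  | andR {P A B} : DerivPF H P A → DerivPF H P B → DerivPF H P (Fm.inter A B)
  | oneL {Γ Δ C} : DerivPF H (Γ ++ Δ) C → DerivPF H (Γ ++ [Fm.one] ++ Δ) C

/-- Derivability from hypotheses `H` in the product-free, constant-free fragment
`L^Λ_{\,/}(∧)`: additionally without the axioms/rules `1R`, `1L`, `0L`. -/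
inductive DerivPFNC (H : Set (List Fm × Fm)) : List Fm → Fm → Prop
  | hyp {P B} : (P, B) ∈ H → DerivPFNC H P B
  | id (A) : DerivPFNC H [A] A
  | cut {P A Γ Δ C} : DerivPFNC H P A → DerivPFNC H (Γ ++ [A] ++ Δ) C →
      DerivPFNC H (Γ ++ P ++ Δ) C
  | ldivL {P A Γ B Δ C} : DerivPFNC H P A → DerivPFNC H (Γ ++ [B] ++ Δ) C →
      DerivPFNC H (Γ ++ P ++ [Fm.ldiv A B] ++ Δ) C
  | ldivR {P A B} : DerivPFNC H (A :: P) B → DerivPFNC H P (Fm.ldiv A B)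
  | rdivL {P A Γ B Δ C} : DerivPFNC H P A → DerivPFNC H (Γ ++ [B] ++ Δ) C →
      DerivPFNC H (Γ ++ [Fm.rdiv B A] ++ P ++ Δ) C
  | rdivR {P A B} : DerivPFNC H (P ++ [A]) B → DerivPFNC H P (Fm.rdiv B A)
  | andL1 {Γ A B Δ C} : DerivPFNC H (Γ ++ [A] ++ Δ) C →
      DerivPFNC H (Γ ++ [Fm.inter A B] ++ Δ) C
  | andL2 {Γ A B Δ C} : DerivPFNC H (Γ ++ [B] ++ Δ) C →
      DerivPFNC H (Γ ++ [Fm.inter A B] ++ Δ) C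
  | andR {P A B} : DerivPFNC H P A → DerivPFNC H P B → DerivPFNC H P (Fm.inter A B)

/-- A derivability relation `D` which contains the product-free rules, together with a class `G`
of product-free formulae, closed under subformulae, such that `D` satisfies the rules for every
constant belonging to `G`. -/
structure IsProdFreeCalculus (D : List Fm → Fm → Prop) (G : Fm → Prop) : Prop where
  id (A) : D [A] A
  cut {P A Γ Δ C} : D P A → D (Γ ++ [A] ++ Δ) C → D (Γ ++ P ++ Δ) C
  ldivL {P A Γ B Δ C} : D P A → D (Γ ++ [B] ++ Δ) C → D (Γ ++ P ++ [Fm.ldiv A B] ++ Δ) C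
  ldivR {P A B} : D (A :: P) B → D P (Fm.ldiv A B)
  rdivL {P A Γ B Δ C} : D P A → D (Γ ++ [B] ++ Δ) C → D (Γ ++ [Fm.rdiv B A] ++ P ++ Δ) C
  rdivR {P A B} : D (P ++ [A]) B → D P (Fm.rdiv B A)
  andL1 {Γ A B Δ C} : D (Γ ++ [A] ++ Δ) C → D (Γ ++ [Fm.inter A B] ++ Δ) C
  andL2 {Γ A B Δ C} : D (Γ ++ [B] ++ Δ) C → D (Γ ++ [Fm.inter A B] ++ Δ) C
  andR {P A B} : D P A → D P B → D P (Fm.inter A B)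
  zeroL (Γ Δ C) : G Fm.zero → D (Γ ++ [Fm.zero] ++ Δ) C
  oneR : G Fm.one → D [] Fm.one
  oneL {Γ Δ C} : G Fm.one → D (Γ ++ Δ) C → D (Γ ++ [Fm.one] ++ Δ) C
  not_mul (A B) : ¬ G (Fm.mul A B)
  of_ldiv {A B} : G (Fm.ldiv A B) → G A ∧ G B
  of_rdiv {A B} : G (Fm.rdiv B A) → G B ∧ G A
  of_inter {A B} : G (Fm.inter A B) → G A ∧ G B

/-- The closure of a language with respect to the contexts of a derivability relation `D`: it
consists of the words which are derivable in every context accepting all words of `X`. -/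
def contextClosure (D : List Fm → Fm → Prop) (X : Language Fm) : Language Fm :=
  {Γ | ∀ L R C, (∀ Ξ ∈ X, D (L ++ Ξ ++ R) C) → D (L ++ Γ ++ R) C}

/-- The canonical interpretation of formulae as languages over the alphabet of formulae. -/
def interp (D : List Fm → Fm → Prop) : Fm → Language Fm
  | Fm.var n => {Γ | D Γ (Fm.var n)}
  | Fm.zero => contextClosure D 0
  | Fm.one => contextClosure D 1
  | Fm.mul A B => contextClosure D (interp D A * interp D B)
  | Fm.ldiv A B => {Γ | ∀ Δ ∈ interp D A, Δ ++ Γ ∈ interp D B}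
  | Fm.rdiv B A => {Γ | ∀ Δ ∈ interp D A, Γ ++ Δ ∈ interp D B}
  | Fm.inter A B => interp D A ⊓ interp D B

/-- The interpretation of an antecedent: the concatenation of the interpretations. -/
def interpList (D : List Fm → Fm → Prop) (P : List Fm) : Language Fm :=
  (P.map (interp D)).prod

section Interpretation

variable {D : List Fm → Fm → Prop}

theorem le_contextClosure (X : Language Fm) : X ≤ contextClosure D X :=
  fun _ hΓ _ _ _ h => h _ hΓ

theorem contextClosure_mono {X Y : Language Fm} (h : X ≤ Y) :
    contextClosure D X ≤ contextClosure D Y :=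
  fun _ hΓ L R C hY => hΓ L R C fun Ξ hΞ => hY Ξ (h hΞ)

theorem contextClosure_idem (X : Language Fm) :
    contextClosure D (contextClosure D X) ≤ contextClosure D X :=
  fun _ hΓ L R C hX => hΓ L R C fun _ hΞ => hΞ L R C hX

theorem append_mem_contextClosure {X Y : Language Fm} {Γ : List Fm} (L R : List Fm)
    (hΓ : Γ ∈ contextClosure D X) (h : ∀ Ξ ∈ X, L ++ Ξ ++ R ∈ Y) :
    L ++ Γ ++ R ∈ contextClosure D Y := by
  intro L' R' C hC
  have := hΓ (L' ++ L) (R ++ R') C fun Ξ hΞ => by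
    simpa [List.append_assoc] using hC _ (h Ξ hΞ)
  simpa [List.append_assoc] using this

theorem contextClosure_interp_le (A : Fm) : contextClosure D (interp D A) ≤ interp D A := by
  induction A with
  | var n =>
    intro Γ hΓ
    have := hΓ [] [] (Fm.var n) fun Ξ (hΞ : D Ξ (Fm.var n)) => by simpa using hΞ
    show D Γ (Fm.var n)
    simpa using this
  | zero => exact contextClosure_idem _
  | one => exact contextClosure_idem _
  | mul A B _ _ => exact contextClosure_idem _
  | ldiv A B _ ihB =>
    intro Γ hΓ Δ hΔ
    have := append_mem_contextClosure Δ [] hΓ (Y := interp D B) fun Ξ hΞ => by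
      simpa using hΞ Δ hΔ
    simp only [List.append_nil] at this
    exact ihB this
  | rdiv B A ihB _ =>
    intro Γ hΓ Δ hΔ
    have := append_mem_contextClosure [] Δ hΓ (Y := interp D B) fun Ξ hΞ => by
      simpa using hΞ Δ hΔ
    simp only [List.nil_append] at this
    exact ihB this
  | inter A B ihA ihB =>
    exact le_inf ((contextClosure_mono inf_le_left).trans ihA)
      ((contextClosure_mono inf_le_right).trans ihB)

theorem mul_contextClosure_mul_le {X Y Z : Language Fm} {C : Fm} (h : X * Y * Z ≤ interp D C) :
    X * contextClosure D Y * Z ≤ interp D C := by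
  rintro _ ⟨_, ⟨x, hx, y, hy, rfl⟩, z, hz, rfl⟩
  exact contextClosure_interp_le C <| append_mem_contextClosure x z hy fun Ξ hΞ =>
    h (Language.append_mem_mul (Language.append_mem_mul hx hΞ) hz)

@[simp]
theorem interpList_nil : interpList D [] = 1 := rfl

@[simp]
theorem interpList_cons (A : Fm) (P : List Fm) :
    interpList D (A :: P) = interp D A * interpList D P := by
  simp [interpList]

@[simp]
theorem interpList_append (P Q : List Fm) :
    interpList D (P ++ Q) = interpList D P * interpList D Q := by
  simp [interpList]

theorem interp_mul_ldiv_le (A B : Fm) : interp D A * interp D (Fm.ldiv A B) ≤ interp D B := by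
  rintro _ ⟨a, ha, b, hb, rfl⟩
  exact hb a ha

theorem interp_rdiv_mul_le (A B : Fm) : interp D (Fm.rdiv B A) * interp D A ≤ interp D B := by
  rintro _ ⟨b, hb, a, ha, rfl⟩
  exact hb a ha

/-- Soundness of the full calculus in the canonical interpretation. -/
theorem Deriv.interpList_le {H : Set (List Fm × Fm)}
    (hH : ∀ s ∈ H, interpList D s.1 ≤ interp D s.2) {P : List Fm} {B : Fm} (h : Deriv H P B) :
    interpList D P ≤ interp D B := by
  induction h with
  | hyp h => exact hH _ h
  | id A => simp
  | oneR => exact le_contextClosure _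
  | zeroL Γ Δ C =>
    simp only [interpList_append, interpList_cons, interpList_nil, mul_one]
    exact mul_contextClosure_mul_le (by simp)
  | cut _ _ ih₁ ih₂ =>
    simp only [interpList_append, interpList_cons, interpList_nil, mul_one] at *
    exact le_trans (by gcongr) ih₂
  | @ldivL P A Γ B Δ C _ _ ih₁ ih₂ =>
    simp only [interpList_append, interpList_cons, interpList_nil, mul_one] at *
    refine le_trans ?_ ih₂
    rw [mul_assoc (interpList D Γ)]
    gcongr
    exact (mul_le_mul_left ih₁ _).trans (interp_mul_ldiv_le A B)
  | ldivR _ ih =>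
    intro Γ hΓ Δ hΔ
    rw [interpList_cons] at ih
    exact ih (Language.append_mem_mul hΔ hΓ)
  | @rdivL P A Γ B Δ C _ _ ih₁ ih₂ =>
    simp only [interpList_append, interpList_cons, interpList_nil, mul_one] at *
    refine le_trans ?_ ih₂
    rw [mul_assoc (interpList D Γ)]
    gcongr
    exact (mul_le_mul_right ih₁ _).trans (interp_rdiv_mul_le A B)
  | rdivR _ ih =>
    intro Γ hΓ Δ hΔ
    simp only [interpList_append, interpList_cons, interpList_nil, mul_one] at ih
    exact ih (Language.append_mem_mul hΓ hΔ)
  | mulL _ ih =>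
    simp only [interpList_append, interpList_cons, interpList_nil, mul_one] at *
    exact mul_contextClosure_mul_le ih
  | mulR _ _ ih₁ ih₂ =>
    rw [interpList_append]
    exact (mul_le_mul' ih₁ ih₂).trans (le_contextClosure _)
  | @andL1 Γ A B Δ C _ ih =>
    simp only [interpList_append, interpList_cons, interpList_nil, mul_one] at *
    refine le_trans ?_ ih
    gcongr
    exact inf_le_left
  | @andL2 Γ A B Δ C _ ih =>
    simp only [interpList_append, interpList_cons, interpList_nil, mul_one] at *
    refine le_trans ?_ ih
    gcongr
    exact inf_le_right
  | andR _ _ ih₁ ih₂ => exact le_inf ih₁ ih₂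
  | oneL _ ih =>
    simp only [interpList_append, interpList_cons, interpList_nil, mul_one] at *
    exact mul_contextClosure_mul_le (by simpa using ih)

end Interpretation

namespace IsProdFreeCalculus

variable {D : List Fm → Fm → Prop} {G : Fm → Prop}

/-- Formulae of the class `G` are interpreted by the languages of words deriving them. -/
theorem mem_interp_iff (hD : IsProdFreeCalculus D G) {A : Fm} (hA : G A) (Γ : List Fm) :
    Γ ∈ interp D A ↔ D Γ A := by
  induction A generalizing Γ with
  | var n => exact Iff.rfl
  | zero =>
    constructor
    · intro h
      simpa using h [] [] Fm.zero fun Ξ hΞ => (Language.notMem_zero Ξ hΞ).elim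
    · exact fun h L R C _ => hD.cut h (hD.zeroL L R C hA)
  | one =>
    constructor
    · intro h
      have := h [] [] Fm.one fun Ξ hΞ => by
        obtain rfl := (Language.mem_one Ξ).1 hΞ
        exact hD.oneR hA
      simpa using this
    · intro h L R C hC
      refine hD.cut h (hD.oneL hA ?_)
      simpa using hC [] Language.nil_mem_one
  | mul A B => exact (hD.not_mul A B hA).elim
  | ldiv A B ihA ihB =>
    obtain ⟨hA, hB⟩ := hD.of_ldiv hA
    constructor
    · intro h
      exact hD.ldivR <| (ihB hB _).1 <| h [A] <| (ihA hA _).2 <| hD.id A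
    · intro h Δ hΔ
      have h₁ := hD.ldivL (Γ := []) (Δ := []) ((ihA hA _).1 hΔ) (hD.id B)
      exact (ihB hB _).2 (by simpa using hD.cut (Δ := []) h h₁)
  | rdiv B A ihB ihA =>
    obtain ⟨hB, hA⟩ := hD.of_rdiv hA
    constructor
    · intro h
      exact hD.rdivR <| (ihB hB _).1 <| h [A] <| (ihA hA _).2 <| hD.id A
    · intro h Δ hΔ
      have h₁ := hD.rdivL (Γ := []) (Δ := []) ((ihA hA _).1 hΔ) (hD.id B)
      exact (ihB hB _).2 (by simpa using hD.cut (Γ := []) (Δ := Δ) h (by simpa using h₁))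
  | inter A B ihA ihB =>
    obtain ⟨hA, hB⟩ := hD.of_inter hA
    constructor
    · rintro ⟨h₁, h₂⟩
      exact hD.andR ((ihA hA _).1 h₁) ((ihB hB _).1 h₂)
    · intro h
      have h₁ := hD.cut (Γ := []) (Δ := []) h (hD.andL1 (hD.id A))
      have h₂ := hD.cut (Γ := []) (Δ := []) h (hD.andL2 (hD.id B))
      exact ⟨(ihA hA _).2 (by simpa using h₁), (ihB hB _).2 (by simpa using h₂)⟩

theorem mem_interpList_self (hD : IsProdFreeCalculus D G) {P : List Fm} (hP : ∀ A ∈ P, G A) :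
    P ∈ interpList D P := by
  induction P with
  | nil => exact Language.nil_mem_one
  | cons A P ih =>
    rw [List.forall_mem_cons] at hP
    rw [interpList_cons]
    exact Language.append_mem_mul ((hD.mem_interp_iff hP.1 [A]).2 (hD.id A)) (ih hP.2)

theorem cut_interpList (hD : IsProdFreeCalculus D G) {P Γ : List Fm} {B : Fm}
    (hP : ∀ A ∈ P, G A) (hΓ : Γ ∈ interpList D P) (L : List Fm) (h : D (L ++ P) B) :
    D (L ++ Γ) B := by
  induction P generalizing L Γ with
  | nil =>
    obtain rfl := (Language.mem_one Γ).1 hΓ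
    exact h
  | cons A P ih =>
    rw [List.forall_mem_cons] at hP
    rw [interpList_cons] at hΓ
    obtain ⟨a, ha, b, hb, rfl⟩ := hΓ
    have h₁ := hD.cut (Γ := L) (Δ := P) ((hD.mem_interp_iff hP.1 a).1 ha) (by simpa using h)
    simpa using ih hP.2 hb (L ++ a) h₁

theorem of_deriv (hD : IsProdFreeCalculus D G) {H : Set (List Fm × Fm)}
    (hHD : ∀ s ∈ H, D s.1 s.2) (hH : ∀ s ∈ H, (∀ A ∈ s.1, G A) ∧ G s.2)
    {P : List Fm} {B : Fm} (hP : ∀ A ∈ P, G A) (hB : G B) (h : Deriv H P B) : D P B := by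
  refine (hD.mem_interp_iff hB P).1 (h.interpList_le ?_ (hD.mem_interpList_self hP))
  exact fun s hs Γ hΓ => (hD.mem_interp_iff (hH s hs).2 Γ).2 <|
    hD.cut_interpList (hH s hs).1 hΓ [] (hHD s hs)

end IsProdFreeCalculus

theorem DerivPF.isProdFreeCalculus (H : Set (List Fm × Fm)) :
    IsProdFreeCalculus (DerivPF H) ProdFree where
  id := .id
  cut := .cut
  ldivL := .ldivL
  ldivR := .ldivR
  rdivL := .rdivL
  rdivR := .rdivR
  andL1 := .andL1
  andL2 := .andL2
  andR := .andR
  zeroL Γ Δ C _ := .zeroL Γ Δ C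
  oneR _ := .oneR
  oneL _ := .oneL
  not_mul _ _ h := h
  of_ldiv h := h
  of_rdiv h := h
  of_inter h := h

theorem DerivPFNC.isProdFreeCalculus (H : Set (List Fm × Fm)) :
    IsProdFreeCalculus (DerivPFNC H) fun A => ProdFree A ∧ ConstFree A where
  id := .id
  cut := .cut
  ldivL := .ldivL
  ldivR := .ldivR
  rdivL := .rdivL
  rdivR := .rdivR
  andL1 := .andL1
  andL2 := .andL2
  andR := .andR
  zeroL _ _ _ h := h.2.elim
  oneR h := h.2.elim
  oneL h := h.2.elim
  not_mul _ _ h := h.1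
  of_ldiv h := ⟨⟨h.1.1, h.2.1⟩, h.1.2, h.2.2⟩
  of_rdiv h := ⟨⟨h.1.1, h.2.1⟩, h.1.2, h.2.2⟩
  of_inter h := ⟨⟨h.1.1, h.2.1⟩, h.1.2, h.2.2⟩

/-- Strong conservativity: if `H` and `Π → B` are in the product-free language and
`Π → B` is derivable from `H` in `L^Λ(∧,0,1)`, then `Π → B` is derivable from `H` in
the product-free fragment `L^Λ_{\,/}(∧,0,1)`; moreover, if `H` and `Π → B` contain no
constants 0 and 1, then `Π → B` is derivable from `H` in `L^Λ_{\,/}(∧)`. -/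
theorem strong_conservativity (H : Set (List Fm × Fm))
    (hH : ∀ s ∈ H, (∀ A ∈ s.1, ProdFree A) ∧ ProdFree s.2)
    (P : List Fm) (B : Fm)
    (hP : ∀ A ∈ P, ProdFree A) (hB : ProdFree B)
    (h : Deriv H P B) :
    DerivPF H P B ∧
    ((∀ s ∈ H, (∀ A ∈ s.1, ConstFree A) ∧ ConstFree s.2) →
      (∀ A ∈ P, ConstFree A) → ConstFree B →
      DerivPFNC H P B) := by
  refine ⟨(DerivPF.isProdFreeCalculus H).of_deriv (fun _ hs => .hyp hs) hH hP hB h, ?_⟩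
  intro hH' hP' hB'
  exact (DerivPFNC.isProdFreeCalculus H).of_deriv (fun _ hs => .hyp hs)
    (fun s hs => ⟨fun A hA => ⟨(hH s hs).1 A hA, (hH' s hs).1 A hA⟩, (hH s hs).2, (hH' s hs).2⟩)
    (fun A hA => ⟨hP A hA, hP' A hA⟩) ⟨hB, hB'⟩ h
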